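/- Let p,q,α,β ∈ (0,1) satisfy pβ < qα and the balance condition αp/((1−α)(1−p)) = βq/((1−β)(1−q)), and set c = (β/(1−β))·((1−α)/α), γ = (α−β)/(1−β). Define π(0)=1−c and π(k)=cγ(1−γ)^(k−1) for k≥1; a(0)=1−p and a(k)=pα(1−α)^(k−1) for k≥1; s(0)=1−q and s(k)=qβ(1−β)^(k−1) for k≥1; s̄(x)=Σ_{j≥x}s(j); and u(m,r)=s(m−r) for r≥1, u(m,0)=s̄(m). Then for all integers m ≥ 0 and all integers k, r with 0 ≤ k ≤ m and 0 ≤ r ≤ m, the detailed-balance identity π(k)·a(m−k)·u(m,r) = π(r)·a(m−r)·u(m,k) holds. -/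

import Mathlib

/-- Probability mass function of the Bernoulli-geometric distribution `BerGeom(p, a)`:
mass `1 - p` at `0` and mass `p * a * (1-a)^(k-1)` at each `k ≥ 1`. -/
noncomputable def bgPMF (p a : ℝ) (k : ℕ) : ℝ :=
  if k = 0 then 1 - p else p * a * (1 - a) ^ (k - 1)

/-- Tail function `s̄(x) = Σ_{j ≥ x} s(j)` of the `BerGeom(q, β)` pmf. -/
noncomputable def bgTail (q β : ℝ) (x : ℕ) : ℝ :=
  ∑' j : {j : ℕ // x ≤ j}, bgPMF q β (j : ℕ)

/-- Transition mass `u(m, r)`: `s(m - r)` for `r ≥ 1`, and `s̄(m)` for `r = 0`. -/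
noncomputable def uFun (q β : ℝ) (m r : ℕ) : ℝ :=
  if r = 0 then bgTail q β m else bgPMF q β (m - r)

theorem bgPMF_zero (p a : ℝ) : bgPMF p a 0 = 1 - p := if_pos rfl

theorem bgPMF_succ (p a : ℝ) (k : ℕ) : bgPMF p a (k + 1) = p * a * (1 - a) ^ k := by
  simp [bgPMF]

/-- The tail of the Bernoulli-geometric distribution is geometric away from `0`. -/
theorem bgTail_succ {q β : ℝ} (hβ : β ∈ Set.Ioo (0 : ℝ) 1) (n : ℕ) :
    bgTail q β (n + 1) = q * (1 - β) ^ n := by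
  let e : ℕ ≃ {j : ℕ // n + 1 ≤ j} :=
    { toFun := fun i => ⟨n + i + 1, by lia⟩
      invFun := fun j => j.1 - (n + 1)
      left_inv := fun i => by simp only; lia
      right_inv := fun ⟨j, hj⟩ => by simp only [Subtype.mk.injEq]; lia }
  have hmass (i : ℕ) : bgPMF q β (e i : ℕ) = q * β * (1 - β) ^ n * (1 - β) ^ i := by
    change bgPMF q β (n + i + 1) = _
    rw [bgPMF_succ]
    ring
  rw [bgTail, ← e.tsum_eq]
  simp only [hmass]
  rw [tsum_mul_left, tsum_geometric_of_lt_one (by linarith [hβ.2]) (by linarith [hβ.1])]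
  have hβ0 : β ≠ 0 := hβ.1.ne'
  rw [sub_sub_cancel]
  field_simp

/-- The detailed-balance identity for a pair `k < r ≤ m`, with `r = k + d + 1`, `m = r + e`. -/
theorem detailed_balance_of_lt {p q α β : ℝ} (hα : α ∈ Set.Ioo (0 : ℝ) 1)
    (hβ : β ∈ Set.Ioo (0 : ℝ) 1)
    (hbal : p * α * (1 - q) * (1 - β) = q * β * (1 - p) * (1 - α)) (k d e : ℕ) :
    bgPMF (β / (1 - β) * ((1 - α) / α)) ((α - β) / (1 - β)) k * bgPMF p α (d + e + 1) *
        bgPMF q β e =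
      bgPMF (β / (1 - β) * ((1 - α) / α)) ((α - β) / (1 - β)) (k + d + 1) * bgPMF p α e *
        (if k = 0 then bgTail q β (d + e + 1) else bgPMF q β (d + e + 1)) := by
  have hα0 : α ≠ 0 := hα.1.ne'
  have hA : 1 - α ≠ 0 := (sub_pos.2 hα.2).ne'
  have hB : 1 - β ≠ 0 := (sub_pos.2 hβ.2).ne'
  have hc : 1 - β / (1 - β) * ((1 - α) / α) = (α - β) / (α * (1 - β)) := by
    field_simp
    ring
  have hγ : 1 - (α - β) / (1 - β) = (1 - α) / (1 - β) := by
    field_simp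
    ring
  have hbal' : bgPMF p α (e + 1) * bgPMF q β e * (1 - β) =
      bgPMF p α e * bgPMF q β (e + 1) * (1 - α) := by
    rcases e with - | e
    · simp only [bgPMF_zero, bgPMF_succ, pow_zero]
      linarith
    · simp only [bgPMF_succ]
      ring
  have hshift : bgPMF p α (d + e + 1) = bgPMF p α (e + 1) * (1 - α) ^ d := by
    simp only [bgPMF_succ]
    ring
  have hshift' : bgPMF q β (d + e + 1) = bgPMF q β (e + 1) * (1 - β) ^ d := by
    simp only [bgPMF_succ]
    ring
  rcases k with - | k
  · rw [if_pos rfl, bgTail_succ hβ, bgPMF_zero, Nat.zero_add, bgPMF_succ _ _ d, hc, hγ, hshift,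
      div_pow]
    rw [bgPMF_succ q β e] at hbal'
    field_simp
    linear_combination (α - β) * (1 - β) ^ d * hbal'
  · rw [if_neg (Nat.succ_ne_zero k), show k + 1 + d + 1 = (k + d + 1) + 1 by lia,
      bgPMF_succ _ _ k, bgPMF_succ _ _ (k + d + 1), hγ, hshift, hshift', div_pow, div_pow]
    field_simp
    linear_combination
      β * (α - β) * (1 - β) ^ k * (1 - β) ^ d * (1 - α) ^ k * (1 - α) ^ d * hbal'

theorem detailed_balance_identity
    (p q α β : ℝ)
    (hp : p ∈ Set.Ioo (0:ℝ) 1) (hα : α ∈ Set.Ioo (0:ℝ) 1)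
    (hq : q ∈ Set.Ioo (0:ℝ) 1) (hβ : β ∈ Set.Ioo (0:ℝ) 1)
    (hstab : p * β < q * α)
    (hbal : α * p / ((1 - α) * (1 - p)) = β * q / ((1 - β) * (1 - q)))
    (c γ : ℝ) (hc : c = β / (1 - β) * ((1 - α) / α)) (hγ : γ = (α - β) / (1 - β)) :
    ∀ m k r : ℕ, k ≤ m → r ≤ m →
      bgPMF c γ k * bgPMF p α (m - k) * uFun q β m r =
      bgPMF c γ r * bgPMF p α (m - r) * uFun q β m k := by
  have hA : 1 - α ≠ 0 := (sub_pos.2 hα.2).ne'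
  have hB : 1 - β ≠ 0 := (sub_pos.2 hβ.2).ne'
  have hP : 1 - p ≠ 0 := (sub_pos.2 hp.2).ne'
  have hQ : 1 - q ≠ 0 := (sub_pos.2 hq.2).ne'
  have hbal' : p * α * (1 - q) * (1 - β) = q * β * (1 - p) * (1 - α) := by
    rw [div_eq_div_iff (mul_ne_zero hA hP) (mul_ne_zero hB hQ)] at hbal
    linarith
  subst hc hγ
  have hlt (m k r : ℕ) (hkr : k < r) (hrm : r ≤ m) :
      bgPMF (β / (1 - β) * ((1 - α) / α)) ((α - β) / (1 - β)) k * bgPMF p α (m - k) *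
          uFun q β m r =
        bgPMF (β / (1 - β) * ((1 - α) / α)) ((α - β) / (1 - β)) r * bgPMF p α (m - r) *
          uFun q β m k := by
    obtain ⟨d, rfl⟩ := Nat.exists_eq_add_of_lt hkr
    obtain ⟨e, rfl⟩ := Nat.exists_eq_add_of_le hrm
    have h := detailed_balance_of_lt hα hβ hbal' k d e
    have hk : k + d + 1 + e - k = d + e + 1 := by lia
    rw [uFun, if_neg (Nat.succ_ne_zero _), uFun, hk, Nat.add_sub_cancel_left, h]
    rcases k with - | k
    · simp only [if_true, show 0 + d + 1 + e = d + e + 1 by lia]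
    · simp only [Nat.succ_ne_zero, if_false]
  intro m k r hk hr
  rcases lt_trichotomy k r with h | rfl | h
  · exact hlt m k r h hr
  · rfl
  · exact (hlt m r k h hk).symm
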